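/- arXiv:0709.4316 — 3 statements merged into one kernel-verified Lean document; each statement's English description precedes it below -/
import Mathlib

section
/- Fix w > 0, θ ∈ ℝ and c > 0. Then the function x ↦ g(x,c,θ) = (w + φ(x))/φ(x−θ) − c is strictly convex on ℝ; equivalently, its derivative with respect to x is a strictly increasing function of x ∈ ℝ. -/
open Real Set

/-- The standard normal density. -/
noncomputable def phi (x : ℝ) : ℝ := (Real.sqrt (2 * Real.pi))⁻¹ * Real.exp (-x ^ 2 / 2)

/-- `g(x, c, θ)` for a given weight `w`. -/
noncomputable def g (w x c θ : ℝ) : ℝ := (w + phi x) / phi (x - θ) - c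

lemma g_eq (w x c θ : ℝ) :
    g w x c θ = w * Real.sqrt (2 * Real.pi) * Real.exp ((x - θ) ^ 2 / 2)
      + Real.exp (θ ^ 2 / 2 - θ * x) - c := by
  have hs : Real.sqrt (2 * Real.pi) ≠ 0 := by positivity
  have h₁ : Real.exp ((x - θ) ^ 2 / 2) * Real.exp (-(x - θ) ^ 2 / 2) = 1 := by
    rw [← Real.exp_add, ← Real.exp_zero]
    congr 1
    ring
  have h₂ : Real.exp (θ ^ 2 / 2 - θ * x) * Real.exp (-(x - θ) ^ 2 / 2) =
      Real.exp (-x ^ 2 / 2) := by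
    rw [← Real.exp_add]
    congr 1
    ring
  unfold g phi
  rw [sub_left_inj, div_eq_iff (by positivity), ← h₂]
  linear_combination (-w * Real.sqrt (2 * Real.pi) * (Real.sqrt (2 * Real.pi))⁻¹) * h₁
    - w * mul_inv_cancel₀ hs

lemma hasDerivAt_exp_sub_sq_half (θ x : ℝ) :
    HasDerivAt (fun x => Real.exp ((x - θ) ^ 2 / 2))
      ((x - θ) * Real.exp ((x - θ) ^ 2 / 2)) x := by
  convert ((((hasDerivAt_id' x).sub_const θ).fun_pow 2).div_const 2).exp using 1
  ring

lemma hasDerivAt_exp_sub_mul (θ x : ℝ) :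
    HasDerivAt (fun x => Real.exp (θ ^ 2 / 2 - θ * x))
      (-θ * Real.exp (θ ^ 2 / 2 - θ * x)) x := by
  convert (((hasDerivAt_id' x).const_mul θ).const_sub (θ ^ 2 / 2)).exp using 1
  ring

lemma hasDerivAt_g (w x c θ : ℝ) :
    HasDerivAt (fun x => g w x c θ)
      (w * Real.sqrt (2 * Real.pi) * ((x - θ) * Real.exp ((x - θ) ^ 2 / 2))
        + -θ * Real.exp (θ ^ 2 / 2 - θ * x)) x := by
  simp only [g_eq]
  exact (((hasDerivAt_exp_sub_sq_half θ x).const_mul _).add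
    (hasDerivAt_exp_sub_mul θ x)).sub_const c

lemma strictMono_deriv_g (w c θ : ℝ) (hw : 0 < w) :
    StrictMono (deriv (fun x => g w x c θ)) := by
  rw [show deriv (fun x => g w x c θ) = _ from funext fun x => (hasDerivAt_g w x c θ).deriv]
  refine strictMono_of_deriv_pos fun x => ?_
  have h := ((((hasDerivAt_id' x).sub_const θ).mul (hasDerivAt_exp_sub_sq_half θ x)).const_mul
    (w * Real.sqrt (2 * Real.pi))).add ((hasDerivAt_exp_sub_mul θ x).const_mul (-θ))
  refine lt_of_lt_of_eq ?_ h.deriv.symm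
  have hpos : 0 < w * Real.sqrt (2 * Real.pi) * ((1 + (x - θ) ^ 2) * Real.exp ((x - θ) ^ 2 / 2))
      + θ ^ 2 * Real.exp (θ ^ 2 / 2 - θ * x) := by positivity
  refine lt_of_lt_of_eq hpos ?_
  ring

/-- for fixed `w > 0`, `θ ∈ ℝ` and `c > 0`, the function
`x ↦ g(x, c, θ)` is strictly convex on `ℝ`; equivalently, its derivative with respect
to `x` is a strictly increasing function of `x`. -/
theorem stmt_1 (w θ c : ℝ) (hw : 0 < w) (hc : 0 < c) :
    StrictConvexOn ℝ Set.univ (fun x => g w x c θ) ∧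
      StrictMono (deriv (fun x => g w x c θ)) := by
  have h := strictMono_deriv_g w c θ hw
  refine ⟨StrictMono.strictConvexOn_univ_of_deriv ?_ h, h⟩
  exact continuous_iff_continuousAt.2 fun x => (hasDerivAt_g w x c θ).continuousAt
end

section
/- Let 0 < α < 1, w > 0 and θ ∈ ℝ. Then there exists c > 0 such that the N(θ,1) probability of the set B(c,θ) equals exactly 1 − α. -/
open Real Set MeasureTheory ProbabilityTheory

/-- The set `B(c, θ) = {x : g(x, c, θ) < 0}` for a given weight `w`. -/
def B (w c θ : ℝ) : Set ℝ := {x : ℝ | g w x c θ < 0}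

/-- A level set of a strictly convex function on the real line is finite. -/
theorem StrictConvexOn.finite_levelSet {f : ℝ → ℝ} (hf : StrictConvexOn ℝ univ f) (c : ℝ) :
    {x | f x = c}.Finite := by
  have no_three : ∀ x y z : ℝ, x < y → y < z → f x = c → f y = c → f z ≠ c := by
    intro x y z hxy hyz hx hy hz
    have := hf.lt_on_openSegment (mem_univ x) (mem_univ z) (hxy.trans hyz).ne
      (openSegment_eq_Ioo (hxy.trans hyz) ▸ ⟨hxy, hyz⟩ : y ∈ openSegment ℝ x z)
    simp [hx, hy, hz] at this
  by_cases hS : {x | f x = c}.Subsingleton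
  · exact hS.finite
  · obtain ⟨a, ha, b, hb, hab⟩ := (Set.not_subsingleton_iff.mp hS).exists_lt
    refine (Set.toFinite {a, b}).subset fun x hx => ?_
    by_contra hne
    simp only [mem_insert_iff, mem_singleton_iff, not_or] at hne
    rcases lt_or_gt_of_ne hne.1 with h | h
    · exact no_three x a b h hab hx ha hb
    · rcases lt_or_gt_of_ne hne.2 with h' | h'
      · exact no_three a x b h h' ha hx hb
      · exact no_three a b x hab h' ha hb hx

/-- The distribution function of a probability measure without atoms is continuous. -/
theorem continuous_cdf_of_forall_singleton (μ : Measure ℝ) [IsProbabilityMeasure μ]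
    (hμ : ∀ x, μ {x} = 0) : Continuous (cdf μ) := by
  refine continuous_iff_continuousAt.mpr fun x => ?_
  rw [(monotone_cdf μ).continuousAt_iff_leftLim_eq_rightLim, StieltjesFunction.rightLim_eq]
  have h := hμ x
  rw [← measure_cdf μ, StieltjesFunction.measure_singleton, ENNReal.ofReal_eq_zero] at h
  exact le_antisymm ((monotone_cdf μ).leftLim_le le_rfl) (by linarith)

/-- A probability measure on the real line without atoms has quantiles of every level. -/
theorem exists_measure_Iio_eq (μ : Measure ℝ) [IsProbabilityMeasure μ]
    (hμ : ∀ x, μ {x} = 0) {p : ℝ} (hp0 : 0 < p) (hp1 : p < 1) :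
    ∃ c, μ (Iio c) = ENNReal.ofReal p := by
  obtain ⟨c, hc⟩ := mem_range_of_exists_le_of_exists_ge
    (continuous_cdf_of_forall_singleton μ hμ)
    (((tendsto_cdf_atBot μ).eventually_le_const hp0).exists)
    (((tendsto_cdf_atTop μ).eventually_const_le hp1).exists)
  refine ⟨c, ?_⟩
  rw [← hc, ofReal_cdf, ← Iio_union_right]
  exact le_antisymm (measure_mono subset_union_left)
    ((measure_union_le _ _).trans (by simp [hμ c]))

theorem phi_pos (x : ℝ) : 0 < phi x := by
  unfold phi
  positivity

theorem continuous_phi : Continuous phi := by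
  unfold phi
  fun_prop

theorem weighted_ratio_eq (w x θ : ℝ) :
    (w + phi x) / phi (x - θ) =
      w * √(2 * π) * exp ((x - θ) ^ 2 / 2) + exp (θ ^ 2 / 2 - θ * x) := by
  have h : exp (-(x - θ) ^ 2 / 2) * exp ((x - θ) ^ 2 / 2) = 1 := by
    rw [← exp_add, ← exp_zero]; congr 1; ring
  have h' : exp (-(x - θ) ^ 2 / 2) * exp (θ ^ 2 / 2 - θ * x) = exp (-x ^ 2 / 2) := by
    rw [← exp_add]; congr 1; ring
  have hs : (√(2 * π))⁻¹ * √(2 * π) = 1 := inv_mul_cancel₀ (by positivity)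
  rw [div_eq_iff (phi_pos _).ne']
  unfold phi
  linear_combination (-w * exp (-(x - θ) ^ 2 / 2) * exp ((x - θ) ^ 2 / 2)) * hs
    - w * h - (√(2 * π))⁻¹ * h'

theorem strictConvexOn_weighted_ratio {w : ℝ} (hw : 0 < w) (θ : ℝ) :
    StrictConvexOn ℝ univ fun x => (w + phi x) / phi (x - θ) := by
  have hq : StrictConvexOn ℝ univ fun x : ℝ => exp ((x - θ) ^ 2 / 2) := by
    refine ⟨convex_univ, fun x _ y _ hxy a b ha hb hab => ?_⟩
    refine lt_of_lt_of_le (exp_lt_exp.mpr ?_)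
      (convexOn_exp.2 (mem_univ ((x - θ) ^ 2 / 2)) (mem_univ ((y - θ) ^ 2 / 2)) ha.le hb.le hab)
    have hpos : 0 < a * b * (x - y) ^ 2 :=
      mul_pos (mul_pos ha hb) (sq_pos_of_ne_zero (sub_ne_zero.mpr hxy))
    obtain rfl : b = 1 - a := by linarith
    simp only [smul_eq_mul]
    nlinarith
  have hl : ConvexOn ℝ univ fun x : ℝ => exp (θ ^ 2 / 2 - θ * x) := by
    refine ⟨convex_univ, fun x _ y _ a b ha hb hab => ?_⟩
    convert convexOn_exp.2 (mem_univ (θ ^ 2 / 2 - θ * x)) (mem_univ (θ ^ 2 / 2 - θ * y))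
      ha hb hab using 2
    simp only [smul_eq_mul]
    linear_combination (-θ ^ 2 / 2) * hab
  have hk : 0 < w * √(2 * π) := by positivity
  simp only [weighted_ratio_eq]
  refine StrictConvexOn.add_convexOn ⟨convex_univ, fun x _ y _ hxy a b ha hb hab => ?_⟩ hl
  have := mul_lt_mul_of_pos_left (hq.2 (mem_univ x) (mem_univ y) hxy ha hb hab) hk
  simp only [smul_eq_mul] at this ⊢
  linarith

/-- let `0 < α < 1`, `w > 0` and `θ ∈ ℝ`. Then there exists `c > 0` such that the
`N(θ,1)` probability of `B(c, θ)` equals exactly `1 − α`. -/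
theorem stmt_5 (α w θ : ℝ) (hα : 0 < α) (hα1 : α < 1) (hw : 0 < w) :
    ∃ c : ℝ, 0 < c ∧ gaussianReal θ 1 (B w c θ) = ENNReal.ofReal (1 - α) := by
  set h : ℝ → ℝ := fun x => (w + phi x) / phi (x - θ)
  have hm : Measurable h :=
    ((continuous_const.add continuous_phi).div
      (continuous_phi.comp (continuous_id.sub continuous_const))
      fun x => (phi_pos _).ne').measurable
  have hB : ∀ c, B w c θ = h ⁻¹' Iio c := fun c => by
    ext x
    simp [B, g, h]
  have : IsProbabilityMeasure ((gaussianReal θ 1).map h) :=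
    Measure.isProbabilityMeasure_map hm.aemeasurable
  have hatom : ∀ c, (gaussianReal θ 1).map h {c} = 0 := fun c => by
    rw [Measure.map_apply hm (measurableSet_singleton c)]
    exact gaussianReal_absolutelyContinuous θ one_ne_zero
      (((strictConvexOn_weighted_ratio hw θ).finite_levelSet c).measure_zero volume)
  obtain ⟨c, hc⟩ := exists_measure_Iio_eq _ hatom (sub_pos.mpr hα1) (sub_lt_self 1 hα)
  rw [Measure.map_apply hm measurableSet_Iio, ← hB] at hc
  refine ⟨c, ?_, hc⟩
  have hpos : gaussianReal θ 1 (B w c θ) ≠ 0 := by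
    simpa [hc] using hα1
  obtain ⟨x, hx⟩ := nonempty_of_measure_ne_zero hpos
  rw [hB] at hx
  exact (div_pos (add_pos hw (phi_pos x)) (phi_pos (x - θ))).trans hx
end

section
/- Let 0 < α < 1 and w > 0, and let c : ℝ → (0,∞) be a function such that for every θ ∈ ℝ the N(θ,1) probability of B(c(θ),θ) equals 1 − α. Define the confidence set C(x) = {θ ∈ ℝ : (w + φ(x))/φ(x−θ) < c(θ)} for x ∈ ℝ. Then there exists M > 0 such that for every x with |x| > M the set C(x) is an interval (a convex subset of ℝ), and moreover inf C(x) − (x − z_{α/2}) → 0 and sup C(x) − (x + z_{α/2}) → 0 as |x| → ∞. -/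
open Real Set MeasureTheory ProbabilityTheory Filter

/-- The standard normal cumulative distribution function. -/
noncomputable def Phi (x : ℝ) : ℝ := ∫ t in Set.Iic x, phi t

/-- The confidence set `C(x) = {θ : (w + φ(x))/φ(x − θ) < c(θ)}`. -/
def C (w : ℝ) (c : ℝ → ℝ) (x : ℝ) : Set ℝ := {θ : ℝ | (w + phi x) / phi (x - θ) < c θ}

open scoped Topology

instance isOpenPosMeasure_gaussianReal_one (m : ℝ) : (gaussianReal m 1).IsOpenPosMeasure :=
  (gaussianReal_absolutelyContinuous' m one_ne_zero).isOpenPosMeasure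

lemma gaussianReal_apply_eq_standard (m : ℝ) {s : Set ℝ} (hs : MeasurableSet s) :
    gaussianReal m 1 s = gaussianReal 0 1 {y | y + m ∈ s} := by
  have h := gaussianReal_map_add_const (μ := 0) (v := 1) m
  rw [zero_add] at h
  rw [← h, Measure.map_apply (by fun_prop) hs]
  rfl

lemma standard_gaussian_neg {s : Set ℝ} (hs : MeasurableSet s) :
    gaussianReal 0 1 {y | -y ∈ s} = gaussianReal 0 1 s := by
  have h := gaussianReal_map_neg (μ := 0) (v := 1)
  rw [neg_zero] at h
  conv_rhs => rw [← h, Measure.map_apply (by fun_prop) hs]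
  rfl

lemma phi_eq_gaussianPDFReal : phi = gaussianPDFReal 0 1 := by
  ext x
  simp [phi, gaussianPDFReal]

lemma Phi_eq_real_Iio (z : ℝ) : Phi z = (gaussianReal 0 1).real (Iio z) := by
  have : NullSingletonClass (gaussianReal 0 1) := nullSingletonClass_gaussianReal one_ne_zero
  rw [measureReal_congr Iio_ae_eq_Iic, measureReal_def,
    gaussianReal_apply_eq_integral 0 one_ne_zero,
    ENNReal.toReal_ofReal (integral_nonneg fun _ => gaussianPDFReal_nonneg _ _ _), Phi,
    phi_eq_gaussianPDFReal]

lemma standard_gaussian_Ioi_neg (z : ℝ) :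
    (gaussianReal 0 1).real (Ioi (-z)) = (gaussianReal 0 1).real (Iio z) := by
  rw [measureReal_def, measureReal_def, ← standard_gaussian_neg measurableSet_Iio]
  congr 2
  ext y
  simp [neg_lt]

lemma pos_of_half_lt_Phi {z : ℝ} (hz : 1 / 2 < Phi z) : 0 < z := by
  by_contra! h
  have hd : Disjoint (Iio z) (Ioi (-z)) :=
    Set.disjoint_left.2 fun y hy hy' => by simp only [mem_Iio, mem_Ioi] at hy hy'; linarith
  have h1 := measureReal_union (μ := gaussianReal 0 1) hd measurableSet_Ioi
  rw [standard_gaussian_Ioi_neg, ← Phi_eq_real_Iio] at h1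
  linarith [measureReal_le_one (μ := gaussianReal 0 1) (s := Iio z ∪ Ioi (-z))]

lemma standard_gaussian_Ioo_neg {z : ℝ} (hz : 0 < z) :
    gaussianReal 0 1 (Ioo (-z) z) = ENNReal.ofReal (2 * Phi z - 1) := by
  have hu : Iio z ∪ Ioi (-z) = univ := by
    ext y
    simp only [mem_union, mem_Iio, mem_Ioi, mem_univ, iff_true]
    by_contra! h
    linarith
  have hi : Iio z ∩ Ioi (-z) = Ioo (-z) z := by
    ext y
    simp [and_comm]
  have h1 := measureReal_union_add_inter (μ := gaussianReal 0 1) (s := Iio z)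
    (measurableSet_Ioi (a := -z))
  rw [hu, hi, standard_gaussian_Ioi_neg, ← Phi_eq_real_Iio, probReal_univ] at h1
  rw [← ofReal_measureReal]
  congr 1
  linarith

lemma eq_of_measure_Ioo_eq {μ : Measure ℝ} [IsFiniteMeasure μ] [μ.IsOpenPosMeasure]
    {a b a' b' : ℝ} (hab : a < b) (ha : a' ≤ a) (hb : b ≤ b')
    (h : μ (Ioo a b) = μ (Ioo a' b')) : a' = a ∧ b = b' := by
  have hsub : Ioo a b ⊆ Ioo a' b' := Ioo_subset_Ioo ha hb
  have hdiff : μ (Ioo a' b' \ Ioo a b) = 0 := by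
    rw [measure_sdiff hsub measurableSet_Ioo.nullMeasurableSet (measure_ne_top _ _), h, tsub_self]
  constructor
  · by_contra hne
    have hlt := lt_of_le_of_ne ha hne
    have : 0 < μ (Ioo a' a) := Measure.measure_Ioo_pos _ |>.2 hlt
    refine this.ne' (measure_mono_null (t := Ioo a' b' \ Ioo a b) (fun y hy => ?_) hdiff)
    exact ⟨⟨hy.1, by linarith [hy.2]⟩, fun h' => by linarith [hy.2, h'.1]⟩
  · by_contra hne
    have hlt := lt_of_le_of_ne hb hne
    have : 0 < μ (Ioo b b') := Measure.measure_Ioo_pos _ |>.2 hlt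
    refine this.ne' (measure_mono_null (t := Ioo a' b' \ Ioo a b) (fun y hy => ?_) hdiff)
    exact ⟨⟨by linarith [hy.1], hy.2⟩, fun h' => by linarith [hy.1, h'.2]⟩

/-- The ratio `(w + φ(θ + y)) / φ(y)`, in the centred variable `y`, with `W = w √(2π)`. -/
noncomputable def centredRatio (W θ y : ℝ) : ℝ :=
  W * exp (y ^ 2 / 2) + exp (-θ ^ 2 / 2 - θ * y)

lemma ratio_eq_centredRatio (w x θ : ℝ) :
    (w + phi x) / phi (x - θ) = centredRatio (w * √(2 * π)) θ (x - θ) := by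
  have hpi : 0 < √(2 * π) := by positivity
  have h1 : exp (-θ ^ 2 / 2 - θ * (x - θ)) = exp (-x ^ 2 / 2) * exp ((x - θ) ^ 2 / 2) := by
    rw [← exp_add]; ring_nf
  have h2 : exp (-(x - θ) ^ 2 / 2) = (exp ((x - θ) ^ 2 / 2))⁻¹ := by rw [← exp_neg]; ring_nf
  rw [centredRatio, h1, phi, phi, h2]
  field_simp

lemma centredRatio_neg (W θ y : ℝ) : centredRatio W (-θ) (-y) = centredRatio W θ y := by
  simp [centredRatio]

lemma continuous_centredRatio (W θ : ℝ) : Continuous (centredRatio W θ) := by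
  unfold centredRatio; fun_prop

lemma convexOn_centredRatio {W : ℝ} (hW : 0 ≤ W) (θ : ℝ) :
    ConvexOn ℝ univ (centredRatio W θ) := by
  have key : ∀ f : ℝ → ℝ, ConvexOn ℝ univ f → ConvexOn ℝ univ fun y => exp (f y) := fun f hf =>
    ⟨convex_univ, fun x _ y _ s t hs ht hst =>
      (exp_le_exp.2 (hf.2 trivial trivial hs ht hst)).trans
        (convexOn_exp.2 trivial trivial hs ht hst)⟩
  refine ConvexOn.add ((key (fun y => y ^ 2 / 2) ?_).smul hW) (key (fun y => -θ ^ 2 / 2 - θ * y) ?_)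
  · refine ⟨convex_univ, fun x _ y _ s t hs ht hst => ?_⟩
    obtain rfl : s = 1 - t := by linarith
    simp only [smul_eq_mul]
    nlinarith [mul_nonneg (mul_nonneg hs ht) (sq_nonneg (x - y))]
  · refine ⟨convex_univ, fun x _ y _ s t hs ht hst => ?_⟩
    obtain rfl : s = 1 - t := by linarith
    simp only [smul_eq_mul]
    exact le_of_eq (by ring)

lemma sq_lt_of_centredRatio_le {W θ y c : ℝ} (hW : 0 < W) (h : centredRatio W θ y ≤ c) :
    y ^ 2 < 2 * c / W := by
  rw [lt_div_iff₀ hW]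
  unfold centredRatio at h
  nlinarith [mul_le_mul_of_nonneg_left (add_one_le_exp (y ^ 2 / 2)) hW.le,
    exp_pos (-θ ^ 2 / 2 - θ * y)]

lemma exists_sublevel_eq_Ioo {W θ c : ℝ} (hW : 0 < W) (hne : {y | centredRatio W θ y < c}.Nonempty) :
    ∃ a b, a < b ∧ {y | centredRatio W θ y < c} = Ioo a b ∧
      centredRatio W θ a = c ∧ centredRatio W θ b = c := by
  set S := {y | centredRatio W θ y < c}
  have hcont := continuous_centredRatio W θ
  have hopen : IsOpen S := isOpen_lt hcont continuous_const
  have hconv : Convex ℝ S := by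
    simpa using (convexOn_centredRatio hW.le θ).convex_lt c
  have hbd : ∀ y ∈ S, |y| ≤ 1 + 2 * c / W := fun y hy => by
    have := sq_lt_of_centredRatio_le hW (le_of_lt hy)
    rw [← sq_abs] at this
    nlinarith [sq_nonneg (|y| - 1), abs_nonneg y]
  have hbb : BddBelow S := ⟨_, fun y hy => (abs_le.1 (hbd y hy)).1⟩
  have hba : BddAbove S := ⟨_, fun y hy => (abs_le.1 (hbd y hy)).2⟩
  have hconn : IsConnected S := ⟨hne, hconv.isPreconnected⟩
  have hinf : sInf S ∉ S := fun h => by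
    obtain ⟨l, hl, hlS⟩ := exists_Ioc_subset_of_mem_nhds (hopen.mem_nhds h) (exists_lt _)
    have := csInf_le hbb (hlS (show (l + sInf S) / 2 ∈ Ioc l (sInf S) by constructor <;> linarith))
    linarith
  have hsup : sSup S ∉ S := fun h => by
    obtain ⟨u, hu, huS⟩ := exists_Ico_subset_of_mem_nhds (hopen.mem_nhds h) (exists_gt _)
    have := le_csSup hba (huS (show (u + sSup S) / 2 ∈ Ico (sSup S) u by constructor <;> linarith))
    linarith
  have hcl : closure S ⊆ {y | centredRatio W θ y ≤ c} :=
    closure_minimal (fun y (hy : centredRatio W θ y < c) => hy.le) (isClosed_le hcont continuous_const)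
  have hIoo : S = Ioo (sInf S) (sSup S) := by
    refine Subset.antisymm (fun y hy => ⟨?_, ?_⟩) (hconn.Ioo_csInf_csSup_subset hbb hba)
    · exact lt_of_le_of_ne (csInf_le hbb hy) fun h => hinf (h ▸ hy)
    · exact lt_of_le_of_ne (le_csSup hba hy) fun h => hsup (h ▸ hy)
  refine ⟨sInf S, sSup S, ?_, hIoo, ?_, ?_⟩
  · obtain ⟨y, hy⟩ := hne
    rw [hIoo] at hy
    exact hy.1.trans hy.2
  · exact le_antisymm (hcl (csInf_mem_closure hne hbb)) (not_lt.1 hinf)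
  · exact le_antisymm (hcl (csSup_mem_closure hne hba)) (not_lt.1 hsup)

lemma exp_sub_exp_le (u v : ℝ) : exp u - exp v ≤ exp u * (u - v) := by
  have h := add_one_le_exp (v - u)
  rw [exp_sub, le_div_iff₀ (exp_pos u)] at h
  linarith

lemma sq_sub_sq_le_exp_sub_exp (a b : ℝ) (h : a ^ 2 ≤ b ^ 2) :
    (b ^ 2 - a ^ 2) / 2 ≤ exp (b ^ 2 / 2) - exp (a ^ 2 / 2) := by
  have h1 := exp_sub_exp_le (a ^ 2 / 2) (b ^ 2 / 2)
  have h2 : 1 ≤ exp (a ^ 2 / 2) := one_le_exp (by positivity)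
  nlinarith

lemma le_of_endpoints_shrink {W κ R θ₁ θ₂ a₁ a₂ b₁ b₂ : ℝ} (hW : 0 < W) (hκ : 0 < κ)
    (ha : a₂ ≤ a₁) (ha₁ : a₁ ≤ -κ) (hb : b₂ ≤ b₁) (hb₂ : κ ≤ b₂) (ha₂ : -R ≤ a₂) (hb₁ : b₁ ≤ R)
    (hθ₁ : 0 ≤ θ₁) (hθ : θ₁ < θ₂) (hδ : θ₂ - θ₁ ≤ (a₁ - a₂) + (b₁ - b₂))
    (h₁ : centredRatio W θ₁ a₁ = centredRatio W θ₁ b₁)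
    (h₂ : centredRatio W θ₂ a₂ = centredRatio W θ₂ b₂) :
    W * κ ≤ exp (-θ₁ ^ 2 / 2 + θ₁ * R) * (2 * θ₁ + R) := by
  unfold centredRatio at h₁ h₂
  set D := (a₁ - a₂) + (b₁ - b₂) with hD
  set e := exp (-θ₁ ^ 2 / 2 + θ₁ * R) with he
  have he0 : 0 < e := exp_pos _
  have hD0 : 0 < D := by linarith
  have hDR : D ≤ 2 * R := by linarith
  have q₁ : κ * (a₁ - a₂) ≤ exp (a₂ ^ 2 / 2) - exp (a₁ ^ 2 / 2) :=
    le_trans (by nlinarith) (sq_sub_sq_le_exp_sub_exp a₁ a₂ (by nlinarith))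
  have q₂ : κ * (b₁ - b₂) ≤ exp (b₁ ^ 2 / 2) - exp (b₂ ^ 2 / 2) :=
    le_trans (by nlinarith) (sq_sub_sq_le_exp_sub_exp b₂ b₁ (by nlinarith))
  have r₁ : exp (-θ₁ ^ 2 / 2 - θ₁ * a₁) - exp (-θ₂ ^ 2 / 2 - θ₂ * a₂) ≤ e * (D * (θ₁ + R)) := by
    refine (exp_sub_exp_le _ _).trans ?_
    refine (mul_le_mul_of_nonneg_left (c := D * (θ₁ + R)) ?_ (exp_pos _).le).trans ?_
    · have t1 : (θ₂ - θ₁) * (θ₁ + (θ₂ - θ₁) / 2) ≤ D * (θ₁ + R) :=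
        mul_le_mul hδ (by linarith) (by linarith) hD0.le
      have t2 : 0 ≤ θ₂ * (a₁ - a₂) := mul_nonneg (by linarith) (by linarith)
      have t3 : 0 ≤ (θ₂ - θ₁) * (-a₁) := mul_nonneg (by linarith) (by linarith)
      nlinarith
    · refine mul_le_mul_of_nonneg_right (exp_le_exp.2 ?_) (mul_nonneg hD0.le (by linarith))
      nlinarith [mul_nonneg hθ₁ (show 0 ≤ R + a₁ by linarith)]
  have r₂ : exp (-θ₂ ^ 2 / 2 - θ₂ * b₂) - exp (-θ₁ ^ 2 / 2 - θ₁ * b₁) ≤ e * (D * θ₁) := by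
    refine (exp_sub_exp_le _ _).trans ?_
    refine (mul_le_mul_of_nonneg_left (c := D * θ₁) ?_ (exp_pos _).le).trans ?_
    · have t1 : 0 ≤ θ₁ * (a₁ - a₂) := mul_nonneg hθ₁ (by linarith)
      have t3 : 0 ≤ (θ₂ - θ₁) * b₂ := mul_nonneg (by linarith) (by linarith)
      have t4 : 0 ≤ (θ₂ - θ₁) * (θ₁ + θ₂) := mul_nonneg (by linarith) (by linarith)
      nlinarith
    · refine mul_le_mul_of_nonneg_right (exp_le_exp.2 ?_) (mul_nonneg hD0.le hθ₁)
      nlinarith [mul_nonneg hθ₁ (show 0 ≤ R by linarith),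
        mul_nonneg (show 0 ≤ θ₂ by linarith) (show 0 ≤ b₂ by linarith)]
  have hfin : D * (W * κ) ≤ D * (e * (2 * θ₁ + R)) := by
    have := mul_le_mul_of_nonneg_left q₁ hW.le
    have := mul_le_mul_of_nonneg_left q₂ hW.le
    rw [hD] at *
    linarith
  exact le_of_mul_le_mul_left hfin hD0

lemma tendsto_exp_neg_sq_mul (R : ℝ) :
    Tendsto (fun θ : ℝ => exp (-θ ^ 2 / 2 + θ * R) * (2 * θ + R)) atTop (𝓝 0) := by
  have h := (tendsto_pow_mul_exp_neg_atTop_nhds_zero 1).const_mul 3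
  rw [mul_zero] at h
  refine squeeze_zero' ?_ ?_ h
  · filter_upwards [eventually_ge_atTop 0, eventually_ge_atTop (-R / 2)] with θ h0 h1
    exact mul_nonneg (exp_pos _).le (by linarith)
  · filter_upwards [eventually_ge_atTop 0, eventually_ge_atTop R,
      eventually_ge_atTop (2 * R + 2)] with θ h0 h1 h2
    have h3 : exp (-θ ^ 2 / 2 + θ * R) ≤ exp (-θ) := exp_le_exp.2 (by nlinarith)
    calc exp (-θ ^ 2 / 2 + θ * R) * (2 * θ + R) ≤ exp (-θ ^ 2 / 2 + θ * R) * (3 * θ) :=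
          mul_le_mul_of_nonneg_left (by linarith) (exp_pos _).le
      _ ≤ exp (-θ) * (3 * θ) := mul_le_mul_of_nonneg_right h3 (by linarith)
      _ = 3 * (θ ^ 1 * exp (-θ)) := by ring

lemma tendsto_exp_neg_sq (R : ℝ) :
    Tendsto (fun θ : ℝ => exp (-θ ^ 2 / 2 + θ * R)) atTop (𝓝 0) := by
  refine squeeze_zero' (Eventually.of_forall fun _ => (exp_pos _).le) ?_ (tendsto_exp_neg_sq_mul R)
  filter_upwards [eventually_ge_atTop (1 - R), eventually_ge_atTop 0] with θ h h0
  exact le_mul_of_one_le_right (exp_pos _).le (by linarith)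

/-- For each `θ`, the set `{y | centredRatio W θ y < c θ}` is the interval `(a θ, b θ)`, at whose
endpoints the ratio equals `c θ`, and it has the same standard normal probability as `(-z, z)`. -/
structure IsAcceptanceFamily (W z : ℝ) (c a b : ℝ → ℝ) : Prop where
  lt : ∀ θ, a θ < b θ
  sublevel : ∀ θ, {y | centredRatio W θ y < c θ} = Ioo (a θ) (b θ)
  left : ∀ θ, centredRatio W θ (a θ) = c θ
  right : ∀ θ, centredRatio W θ (b θ) = c θ
  measure : ∀ θ, gaussianReal 0 1 (Ioo (a θ) (b θ)) = gaussianReal 0 1 (Ioo (-z) z)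

namespace IsAcceptanceFamily

variable {W z : ℝ} {c a b : ℝ → ℝ}

lemma mem_iff (h : IsAcceptanceFamily W z c a b) {θ y : ℝ} :
    centredRatio W θ y < c θ ↔ a θ < y ∧ y < b θ :=
  Set.ext_iff.1 (h.sublevel θ) y

lemma le_cutoff (h : IsAcceptanceFamily W z c a b) (hW : 0 < W) (hz : 0 < z) (θ : ℝ) :
    W * exp (z ^ 2 / 2) ≤ c θ := by
  by_contra! hlt
  have key : ∀ y, centredRatio W θ y = c θ → -z < y ∧ y < z := fun y hy => by
    have h1 : W * exp (y ^ 2 / 2) < W * exp (z ^ 2 / 2) := by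
      unfold centredRatio at hy
      linarith [exp_pos (-θ ^ 2 / 2 - θ * y)]
    have h2 := exp_lt_exp.1 (lt_of_mul_lt_mul_left h1 hW.le)
    exact abs_lt.1 (abs_lt_of_sq_lt_sq (by linarith) hz.le)
  have ha := key _ (h.left θ)
  have hb := key _ (h.right θ)
  linarith [(eq_of_measure_Ioo_eq (h.lt θ) ha.1.le hb.2.le (h.measure θ)).1]

lemma cutoff_le (h : IsAcceptanceFamily W z c a b) (hz : 0 < z) (θ : ℝ) :
    c θ ≤ W * exp (z ^ 2 / 2) + exp (-θ ^ 2 / 2 + |θ| * z) := by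
  by_contra! hlt
  have h1 : a θ < -z ∧ -z < b θ := h.mem_iff.1 <| hlt.trans_le' <| by
    unfold centredRatio
    rw [neg_sq]
    gcongr
    nlinarith [le_abs_self θ]
  have h2 : a θ < z ∧ z < b θ := h.mem_iff.1 <| hlt.trans_le' <| by
    unfold centredRatio
    gcongr
    nlinarith [neg_abs_le θ]
  linarith [(eq_of_measure_Ioo_eq (by linarith) h1.1.le h2.2.le (h.measure θ).symm).1]

lemma exists_abs_le (h : IsAcceptanceFamily W z c a b) (hW : 0 < W) (hz : 0 < z) :
    ∃ R, ∀ θ y, centredRatio W θ y < c θ → |y| ≤ R := by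
  refine ⟨1 + 2 * ((W + 1) * exp (z ^ 2 / 2)) / W, fun θ y hy => ?_⟩
  have h1 : exp (-θ ^ 2 / 2 + |θ| * z) ≤ exp (z ^ 2 / 2) := by
    gcongr
    nlinarith [sq_nonneg (|θ| - z), sq_abs θ]
  have h2 := sq_lt_of_centredRatio_le hW
    (show centredRatio W θ y ≤ (W + 1) * exp (z ^ 2 / 2) by linarith [h.cutoff_le hz θ])
  rw [← sq_abs] at h2
  nlinarith [sq_nonneg (|y| - 1), abs_nonneg y]

lemma eventually_endpoints (h : IsAcceptanceFamily W z c a b) (hW : 0 < W) {ε : ℝ} (hε : 0 < ε)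
    (hεz : ε < z) :
    ∀ᶠ θ in atTop, -(z + ε) ≤ a θ ∧ a θ < -(z - ε) ∧ z - ε < b θ ∧ b θ ≤ z + ε := by
  have hz : 0 < z := hε.trans hεz
  have hinner : 0 < W * exp (z ^ 2 / 2) - W * exp ((z - ε) ^ 2 / 2) :=
    sub_pos.2 (mul_lt_mul_of_pos_left (exp_lt_exp.2 (by nlinarith)) hW)
  have houter : 0 < W * exp ((z + ε) ^ 2 / 2) - W * exp (z ^ 2 / 2) :=
    sub_pos.2 (mul_lt_mul_of_pos_left (exp_lt_exp.2 (by nlinarith)) hW)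
  filter_upwards [(tendsto_exp_neg_sq z).eventually_lt_const hinner,
    (tendsto_exp_neg_sq z).eventually_lt_const houter, eventually_ge_atTop 0] with θ h1 h2 h0
  have hc₁ := h.le_cutoff hW hz θ
  have hc₂ := h.cutoff_le hz θ
  rw [abs_of_nonneg h0] at hc₂
  have m₁ : a θ < z - ε ∧ z - ε < b θ := h.mem_iff.1 <| by
    have : exp (-θ ^ 2 / 2 - θ * (z - ε)) ≤ exp (-θ ^ 2 / 2 + θ * z) := exp_le_exp.2 (by nlinarith)
    unfold centredRatio
    linarith
  have m₂ : a θ < -(z - ε) ∧ -(z - ε) < b θ := h.mem_iff.1 <| by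
    have : exp (-θ ^ 2 / 2 - θ * -(z - ε)) ≤ exp (-θ ^ 2 / 2 + θ * z) := exp_le_exp.2 (by nlinarith)
    unfold centredRatio
    rw [neg_sq]
    linarith
  have m₃ : ¬ (a θ < z + ε ∧ z + ε < b θ) := mt h.mem_iff.2 <| by
    unfold centredRatio
    linarith [exp_pos (-θ ^ 2 / 2 - θ * (z + ε))]
  have m₄ : ¬ (a θ < -(z + ε) ∧ -(z + ε) < b θ) := mt h.mem_iff.2 <| by
    unfold centredRatio
    rw [neg_sq]
    linarith [exp_pos (-θ ^ 2 / 2 - θ * -(z + ε))]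
  refine ⟨?_, m₂.1, m₁.2, ?_⟩
  · by_contra! hlt
    exact m₄ ⟨hlt, by linarith [m₁.2]⟩
  · by_contra! hlt
    exact m₃ ⟨by linarith [m₁.1], hlt⟩

lemma exists_endpoints_strictMono (h : IsAcceptanceFamily W z c a b) (hW : 0 < W) (hz : 0 < z) :
    ∃ T, ∀ θ₁ θ₂, T ≤ θ₁ → θ₁ < θ₂ → θ₁ + a θ₁ < θ₂ + a θ₂ ∧ θ₁ + b θ₁ < θ₂ + b θ₂ := by
  have hWz : 0 < W * (z / 2) := by positivity
  obtain ⟨T, hT⟩ := eventually_atTop.1 <|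
    (h.eventually_endpoints hW (half_pos hz) (half_lt_self hz)).and <|
      ((tendsto_exp_neg_sq_mul (z + z / 2)).eventually_lt_const hWz).and (eventually_ge_atTop 0)
  refine ⟨T, fun θ₁ θ₂ h₁ h₁₂ => ?_⟩
  obtain ⟨⟨p₁, p₂, p₃, p₄⟩, hsmall, h0⟩ := hT θ₁ h₁
  obtain ⟨⟨q₁, q₂, q₃, q₄⟩, -, -⟩ := hT θ₂ (h₁.trans h₁₂.le)
  have hmeas := (h.measure θ₁).trans (h.measure θ₂).symm
  have key : a θ₂ ≤ a θ₁ → b θ₂ ≤ b θ₁ →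
      (a θ₁ - a θ₂) + (b θ₁ - b θ₂) < θ₂ - θ₁ := fun ha hb => by
    by_contra! hδ
    have := le_of_endpoints_shrink hW (half_pos hz) ha (by linarith) hb (by linarith) q₁ p₄ h0 h₁₂
      hδ ((h.left θ₁).trans (h.right θ₁).symm) ((h.left θ₂).trans (h.right θ₂).symm)
    linarith
  constructor
  · by_contra! hlt
    have hb : b θ₂ ≤ b θ₁ := by
      by_contra! hb
      linarith [(eq_of_measure_Ioo_eq (h.lt θ₁) (by linarith) hb.le hmeas).2]
    linarith [key (by linarith) hb]
  · by_contra! hlt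
    have ha : a θ₂ ≤ a θ₁ := by
      by_contra! ha
      linarith [(eq_of_measure_Ioo_eq (h.lt θ₂) ha.le (by linarith) hmeas.symm).1]
    linarith [key ha (by linarith)]

lemma eventually_convex (h : IsAcceptanceFamily W z c a b) (hW : 0 < W) (hz : 0 < z) :
    ∀ᶠ x in atTop, Convex ℝ {θ | centredRatio W θ (x - θ) < c θ} := by
  obtain ⟨R, hR⟩ := h.exists_abs_le hW hz
  obtain ⟨T, hT⟩ := h.exists_endpoints_strictMono hW hz
  filter_upwards [eventually_ge_atTop (T + R)] with x hx
  refine OrdConnected.convex ⟨fun θ₁ hθ₁ θ₂ hθ₂ θ hθ => ?_⟩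
  rcases hθ.1.eq_or_lt with rfl | h₁
  · exact hθ₁
  rcases hθ.2.eq_or_lt with rfl | h₂
  · exact hθ₂
  have hT₁ : T ≤ θ₁ := by linarith [(abs_le.1 (hR θ₁ _ hθ₁)).2]
  have k₁ := (hT θ₁ θ hT₁ h₁).2
  have k₂ := (hT θ θ₂ (by linarith) h₂).1
  have e₁ := (h.mem_iff.1 hθ₁).2
  have e₂ := (h.mem_iff.1 hθ₂).1
  exact h.mem_iff.2 ⟨by linarith, by linarith⟩

lemma eventually_subset (h : IsAcceptanceFamily W z c a b) (hW : 0 < W) {ε : ℝ} (hε : 0 < ε)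
    (hεz : ε < z) :
    ∀ᶠ x in atTop, Icc (x - z + ε) (x + z - ε) ⊆ {θ | centredRatio W θ (x - θ) < c θ} ∧
      {θ | centredRatio W θ (x - θ) < c θ} ⊆ Icc (x - z - ε) (x + z + ε) := by
  obtain ⟨R, hR⟩ := h.exists_abs_le hW (hε.trans hεz)
  obtain ⟨T, hT⟩ := eventually_atTop.1 (h.eventually_endpoints hW hε hεz)
  filter_upwards [eventually_ge_atTop (T + R), eventually_ge_atTop (T + z)] with x hx hx'
  constructor
  · intro θ hθ
    obtain ⟨-, p₂, p₃, -⟩ := hT θ (by linarith [hθ.1])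
    exact h.mem_iff.2 ⟨by linarith [hθ.2], by linarith [hθ.1]⟩
  · intro θ hθ
    obtain ⟨p₁, -, -, p₄⟩ := hT θ (by linarith [(abs_le.1 (hR θ _ hθ)).2])
    have := h.mem_iff.1 hθ
    exact ⟨by linarith [this.2], by linarith [this.1]⟩

lemma tendsto_endpoints (h : IsAcceptanceFamily W z c a b) (hW : 0 < W) (hz : 0 < z) :
    Tendsto (fun x => sInf {θ | centredRatio W θ (x - θ) < c θ} - (x - z)) atTop (𝓝 0) ∧
      Tendsto (fun x => sSup {θ | centredRatio W θ (x - θ) < c θ} - (x + z)) atTop (𝓝 0) := by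
  have key : ∀ ε > 0, ∀ᶠ x in atTop,
      |sInf {θ | centredRatio W θ (x - θ) < c θ} - (x - z)| < ε ∧
        |sSup {θ | centredRatio W θ (x - θ) < c θ} - (x + z)| < ε := fun ε hε => by
    set η := min (ε / 2) (z / 2)
    have hη : 0 < η := lt_min (half_pos hε) (half_pos hz)
    have hηε : η ≤ ε / 2 := min_le_left _ _
    have hηz : η ≤ z / 2 := min_le_right _ _
    filter_upwards [h.eventually_subset hW hη (by linarith)] with x ⟨hin, hout⟩
    set S := {θ | centredRatio W θ (x - θ) < c θ}
    have hl : x - z + η ∈ S := hin ⟨le_rfl, by linarith⟩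
    have hr : x + z - η ∈ S := hin ⟨by linarith, le_rfl⟩
    have i₁ := csInf_le (s := S) ⟨_, fun θ hθ => (hout hθ).1⟩ hl
    have i₂ := le_csInf (s := S) ⟨_, hl⟩ fun θ hθ => (hout hθ).1
    have s₁ := le_csSup (s := S) ⟨_, fun θ hθ => (hout hθ).2⟩ hr
    have s₂ := csSup_le (s := S) ⟨_, hl⟩ fun θ hθ => (hout hθ).2
    constructor <;> rw [abs_lt] <;> constructor <;> linarith
  constructor <;> refine Metric.tendsto_nhds.2 fun ε hε => ?_ <;>
    filter_upwards [key ε hε] with x hx <;> rw [Real.dist_eq, sub_zero]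
  exacts [hx.1, hx.2]

end IsAcceptanceFamily

lemma setOf_centredRatio_lt_eq_C (w : ℝ) (c : ℝ → ℝ) (x : ℝ) :
    {θ | centredRatio (w * √(2 * π)) θ (x - θ) < c θ} = C w c x := by
  simp only [C, ratio_eq_centredRatio]

lemma gaussianReal_B (w c θ : ℝ) : gaussianReal θ 1 (B w c θ) =
    gaussianReal 0 1 {y | centredRatio (w * √(2 * π)) θ y < c} := by
  have hB : B w c θ = {x | centredRatio (w * √(2 * π)) θ (x - θ) < c} := by
    simp only [B, g, ratio_eq_centredRatio, sub_neg]
  have hcont : Continuous fun x => centredRatio (w * √(2 * π)) θ (x - θ) :=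
    (continuous_centredRatio _ _).comp (by fun_prop)
  rw [hB, gaussianReal_apply_eq_standard _ (isOpen_lt hcont continuous_const).measurableSet]
  simp only [mem_ofPred_eq, add_sub_cancel_right]

lemma exists_isAcceptanceFamily {W z : ℝ} {c : ℝ → ℝ} (hW : 0 < W) (hz : 0 < z)
    (h : ∀ θ, gaussianReal 0 1 {y | centredRatio W θ y < c θ} = gaussianReal 0 1 (Ioo (-z) z)) :
    ∃ a b, IsAcceptanceFamily W z c a b := by
  have hne : ∀ θ, {y | centredRatio W θ y < c θ}.Nonempty := fun θ => by
    refine nonempty_of_measure_ne_zero (μ := gaussianReal 0 1) ?_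
    rw [h θ]
    exact ((Measure.measure_Ioo_pos _).2 (by linarith)).ne'
  choose a b hlt hsub ha hb using fun θ => exists_sublevel_eq_Ioo hW (hne θ)
  exact ⟨a, b, hlt, hsub, ha, hb, fun θ => hsub θ ▸ h θ⟩

lemma C_neg (w : ℝ) (c : ℝ → ℝ) (x : ℝ) : C w c (-x) = -C w (fun θ => c (-θ)) x := by
  ext θ
  rw [Set.mem_neg, C, C, mem_ofPred_eq, mem_ofPred_eq, ratio_eq_centredRatio, ratio_eq_centredRatio,
    neg_neg, ← centredRatio_neg, show -(-x - θ) = x - -θ by ring]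

lemma confidence_set_atTop {w z : ℝ} {c : ℝ → ℝ} (hw : 0 < w) (hz : 0 < z)
    (h : ∀ θ, gaussianReal 0 1 {y | centredRatio (w * √(2 * π)) θ y < c θ} =
      gaussianReal 0 1 (Ioo (-z) z)) :
    (∀ᶠ x in atTop, Convex ℝ (C w c x)) ∧
      Tendsto (fun x => sInf (C w c x) - (x - z)) atTop (𝓝 0) ∧
        Tendsto (fun x => sSup (C w c x) - (x + z)) atTop (𝓝 0) := by
  have hW : 0 < w * √(2 * π) := by positivity
  obtain ⟨a, b, hab⟩ := exists_isAcceptanceFamily hW hz h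
  simpa only [setOf_centredRatio_lt_eq_C] using
    And.intro (hab.eventually_convex hW hz) (hab.tendsto_endpoints hW hz)

/-- let `0 < α < 1`, `w > 0`, and `c : ℝ → (0, ∞)` be such that for every `θ` the
`N(θ,1)` probability of `B(c(θ), θ)` equals `1 − α`.  Then there is an `M > 0` such that for
every `x` with `|x| > M` the confidence set `C(x)` is an interval (a convex subset of `ℝ`), and
`inf C(x) − (x − z_{α/2}) → 0` and `sup C(x) − (x + z_{α/2}) → 0` as `|x| → ∞`
(`z_{α/2}` being the upper-`α/2` quantile of `N(0,1)`, i.e. `Φ(z_{α/2}) = 1 − α/2`). -/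
theorem stmt_6 (α w z : ℝ) (hα : 0 < α) (hα1 : α < 1) (hw : 0 < w)
    (hz : Phi z = 1 - α / 2) (c : ℝ → ℝ) (hc : ∀ θ, 0 < c θ)
    (hcov : ∀ θ, gaussianReal θ 1 (B w (c θ) θ) = ENNReal.ofReal (1 - α)) :
    (∃ M : ℝ, 0 < M ∧ ∀ x : ℝ, M < |x| → Convex ℝ (C w c x)) ∧
      Tendsto (fun x => sInf (C w c x) - (x - z)) (cocompact ℝ) (nhds 0) ∧
        Tendsto (fun x => sSup (C w c x) - (x + z)) (cocompact ℝ) (nhds 0) := by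
  have hz0 : 0 < z := pos_of_half_lt_Phi (by rw [hz]; linarith)
  have hmeas : ∀ θ, gaussianReal 0 1 {y | centredRatio (w * √(2 * π)) θ y < c θ} =
      gaussianReal 0 1 (Ioo (-z) z) := fun θ => by
    rw [← gaussianReal_B, hcov, standard_gaussian_Ioo_neg hz0, hz]
    ring_nf
  have hmeas' : ∀ θ, gaussianReal 0 1 {y | centredRatio (w * √(2 * π)) θ y < c (-θ)} =
      gaussianReal 0 1 (Ioo (-z) z) := fun θ => by
    rw [← hmeas (-θ), ← standard_gaussian_neg
      (s := {y | centredRatio (w * √(2 * π)) (-θ) y < c (-θ)})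
      (isOpen_lt (continuous_centredRatio _ _) continuous_const).measurableSet]
    simp only [mem_ofPred_eq, centredRatio_neg]
  obtain ⟨p₁, p₂, p₃⟩ := confidence_set_atTop hw hz0 hmeas
  obtain ⟨q₁, q₂, q₃⟩ := confidence_set_atTop (c := fun θ => c (-θ)) hw hz0 hmeas'
  refine ⟨?_, ?_, ?_⟩
  · obtain ⟨M₁, hM₁⟩ := eventually_atTop.1 p₁
    obtain ⟨M₂, hM₂⟩ := eventually_atTop.1 q₁
    refine ⟨max 1 (max M₁ M₂), by positivity, fun x hx => ?_⟩
    obtain ⟨-, h₁, h₂⟩ : 1 < |x| ∧ M₁ < |x| ∧ M₂ < |x| := by simpa only [max_lt_iff] using hx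
    rcases abs_choice x with hx' | hx'
    · exact hM₁ x (hx' ▸ h₁.le)
    · rw [← neg_neg x, C_neg]
      exact (hM₂ (-x) (hx' ▸ h₂.le)).neg
  · rw [cocompact_eq_atBot_atTop]
    refine Tendsto.sup ?_ p₂
    have := (q₃.comp tendsto_neg_atBot_atTop).neg
    rw [neg_zero] at this
    refine this.congr fun x => ?_
    conv_rhs => rw [← neg_neg x, C_neg, Real.sInf_neg]
    simp only [Function.comp_apply, neg_neg]
    ring
  · rw [cocompact_eq_atBot_atTop]
    refine Tendsto.sup ?_ p₃
    have := (q₂.comp tendsto_neg_atBot_atTop).neg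
    rw [neg_zero] at this
    refine this.congr fun x => ?_
    conv_rhs => rw [← neg_neg x, C_neg, Real.sSup_neg]
    simp only [Function.comp_apply, neg_neg]
    ring
end
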